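/- Let m = 1 and define F₁(p) = X₁ − (1/2)Y₁Y₂ + (1/2)Y₁Y₃, F₂(p) = X₂ − √2·Y₂ + (√2/2)·Y₃ + (1/2)Y₁Y₂, F₃(p) = X₃ − (√2/2)·Y₃ − (1/4)Y₁Y₃. The Spin(7) set 𝓑⁻_{Spin(7)} = ∂𝓔 ∩ 𝓟 ∩ {p : F₁ = F₂ = F₃ = 0} is forward flow-invariant for the Einstein vector field: if c : I → ℝ⁶ is a solution of c'(η) = V(c(η)) on an interval I, η₀, η₁ ∈ I with η₀ ≤ η₁, and c(η₀) ∈ 𝓑⁻_{Spin(7)}, then c(η₁) ∈ 𝓑⁻_{Spin(7)}. -/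

import Mathlib

open Real Set Filter

noncomputable section

/-- The quadratic form `G(p) = X₁² + 2X₂² + 4m X₃²`. -/
def G (m : ℕ) (p : Fin 6 → ℝ) : ℝ := (p 0)^2 + 2*(p 1)^2 + 4*(m:ℝ)*(p 2)^2

/-- `R₁(p) = (1/2)Y₁²Y₂² + (m/4)Y₁²Y₃²`. -/
def R1 (m : ℕ) (p : Fin 6 → ℝ) : ℝ := (1/2)*(p 3)^2*(p 4)^2 + ((m:ℝ)/4)*(p 3)^2*(p 5)^2

/-- `R₂(p) = 2Y₂² − (1/2)Y₁²Y₂² + (m/2)Y₃²`. -/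
def R2 (m : ℕ) (p : Fin 6 → ℝ) : ℝ := 2*(p 4)^2 - (1/2)*(p 3)^2*(p 4)^2 + ((m:ℝ)/2)*(p 5)^2

/-- `R₃(p) = (m+2)Y₂Y₃ − (1/8)Y₁²Y₃² − (1/2)Y₃²`. -/
def R3 (m : ℕ) (p : Fin 6 → ℝ) : ℝ :=
  ((m:ℝ)+2)*(p 4)*(p 5) - (1/8)*(p 3)^2*(p 5)^2 - (1/2)*(p 5)^2

/-- `R_s = R₁ + 2R₂ + 4m R₃`. -/
def Rs (m : ℕ) (p : Fin 6 → ℝ) : ℝ := R1 m p + 2*R2 m p + 4*(m:ℝ)*R3 m p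

/-- `L = (G + R_s − 1)/(4m+2)`. -/
def L (m : ℕ) (p : Fin 6 → ℝ) : ℝ := (G m p + Rs m p - 1)/(4*(m:ℝ)+2)

/-- The Einstein vector field. -/
def V (m : ℕ) (p : Fin 6 → ℝ) : Fin 6 → ℝ :=
  ![ p 0 * (G m p + L m p - 1) + R1 m p - L m p,
     p 1 * (G m p + L m p - 1) + R2 m p - L m p,
     p 2 * (G m p + L m p - 1) + R3 m p - L m p,
     p 3 * (p 0 - p 1),
     p 4 * (G m p + L m p - p 1),
     p 5 * (G m p + L m p + p 1 - 2*p 2) ]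

/-- `𝓔 = {p : X₁+2X₂+4m X₃ = 1 and G + R_s ≤ 1}`. -/
def setE (m : ℕ) : Set (Fin 6 → ℝ) :=
  {p | p 0 + 2*p 1 + 4*(m:ℝ)*p 2 = 1 ∧ G m p + Rs m p ≤ 1}

/-- `∂𝓔 = {p : X₁+2X₂+4m X₃ = 1 and G + R_s = 1}`. -/
def bdryE (m : ℕ) : Set (Fin 6 → ℝ) :=
  {p | p 0 + 2*p 1 + 4*(m:ℝ)*p 2 = 1 ∧ G m p + Rs m p = 1}

/-- `𝓟 = {p : Y₁ ≥ 0, Y₂ ≥ 0, Y₃ ≥ 0}`. -/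
def setP : Set (Fin 6 → ℝ) := {p | 0 ≤ p 3 ∧ 0 ≤ p 4 ∧ 0 ≤ p 5}

/-- `𝓐₁ = {p : X₁ ≤ X₂ and Y₁² ≤ 2}`. -/
def setA1 : Set (Fin 6 → ℝ) := {p | p 0 ≤ p 1 ∧ (p 3)^2 ≤ 2}

/-- `𝓐₂`. -/
def setA2 : Set (Fin 6 → ℝ) :=
  {p | 0 ≤ 2*p 4 - p 5 ∧ 0 ≤ (Real.sqrt 2/2)*(2*p 4 - p 5) + p 2 - p 1 ∧
       p 1 ≤ 1/2 ∧ 0 ≤ p 2}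

/-- The compact invariant set `𝓢`. -/
def setS (m : ℕ) : Set (Fin 6 → ℝ) := setE m ∩ setP ∩ setA1 ∩ setA2

/-- A solution of the Einstein ODE system on a set `I ⊆ ℝ`. -/
def IsSolution (m : ℕ) (I : Set ℝ) (c : ℝ → Fin 6 → ℝ) : Prop :=
  ∀ η ∈ I, HasDerivWithinAt c (V m (c η)) I η

/-- `F₁(p) = X₁ − (1/2)Y₁Y₂ + (1/2)Y₁Y₃`. -/
def F1 (p : Fin 6 → ℝ) : ℝ := p 0 - (1/2)*p 3*p 4 + (1/2)*p 3*p 5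

/-- `F₂(p) = X₂ − √2·Y₂ + (√2/2)·Y₃ + (1/2)Y₁Y₂`. -/
def F2 (p : Fin 6 → ℝ) : ℝ :=
  p 1 - Real.sqrt 2*p 4 + (Real.sqrt 2/2)*p 5 + (1/2)*p 3*p 4

/-- `F₃(p) = X₃ − (√2/2)·Y₃ − (1/4)Y₁Y₃`. -/
def F3 (p : Fin 6 → ℝ) : ℝ := p 2 - (Real.sqrt 2/2)*p 5 - (1/4)*p 3*p 5

/-- A curve vanishing at the left endpoint, whose velocity is bounded by a continuous multiple of
its norm, vanishes identically. -/
theorem eq_zero_of_norm_deriv_le_mul_norm {E : Type*} [NormedAddCommGroup E] [NormedSpace ℝ E]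
    {a b : ℝ} {f f' : ℝ → E} {k : ℝ → ℝ} (hk : ContinuousOn k (Icc a b))
    (hf : ∀ t ∈ Icc a b, HasDerivWithinAt f (f' t) (Icc a b) t)
    (hle : ∀ t ∈ Icc a b, ‖f' t‖ ≤ k t * ‖f t‖) (ha : f a = 0) :
    ∀ t ∈ Icc a b, f t = 0 := by
  obtain ⟨K, hK⟩ := isCompact_Icc.bddAbove_image hk
  refine eq_zero_of_abs_deriv_le_mul_abs_self_of_eq_zero_right (K := K)
    (fun t ht => (hf t ht).continuousWithinAt) (f' := f') (fun t ht => ?_) ha (fun t ht => ?_)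
  · exact (hf t (Ico_subset_Icc_self ht)).mono_of_mem_nhdsWithin (Icc_mem_nhdsGE_of_mem ht)
  · exact (hle t (Ico_subset_Icc_self ht)).trans
      (mul_le_mul_of_nonneg_right (hK (mem_image_of_mem k (Ico_subset_Icc_self ht)))
        (norm_nonneg _))

theorem eq_zero_of_deriv_eq_mul {a b : ℝ} {y g : ℝ → ℝ} (hg : ContinuousOn g (Icc a b))
    (hy : ∀ t ∈ Icc a b, HasDerivWithinAt y (g t * y t) (Icc a b) t) (ha : y a = 0) :
    ∀ t ∈ Icc a b, y t = 0 :=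
  eq_zero_of_norm_deriv_le_mul_norm hg.norm hy (fun _ _ => (norm_mul _ _).le) ha

theorem nonneg_of_deriv_eq_mul {a b : ℝ} {y g : ℝ → ℝ} (hg : ContinuousOn g (Icc a b))
    (hy : ∀ t ∈ Icc a b, HasDerivWithinAt y (g t * y t) (Icc a b) t) (ha : 0 ≤ y a) :
    ∀ t ∈ Icc a b, 0 ≤ y t := by
  intro t ht
  by_contra! hneg
  have hcont : ContinuousOn y (Icc a t) := fun x hx =>
    (hy x ⟨hx.1, hx.2.trans ht.2⟩).continuousWithinAt.mono (Icc_subset_Icc_right ht.2)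
  obtain ⟨r, hr, hr0⟩ := intermediate_value_Icc' ht.1 hcont ⟨hneg.le, ha⟩
  have hsub : Icc r t ⊆ Icc a b := Icc_subset_Icc hr.1 ht.2
  have := eq_zero_of_deriv_eq_mul (hg.mono hsub) (fun x hx => (hy x (hsub hx)).mono hsub) hr0 t
    ⟨hr.2, le_rfl⟩
  exact hneg.ne this

/-- A solution of a linear system with continuous coefficients that vanishes at the left endpoint
vanishes identically. -/
theorem eq_zero_of_linear_system {ι : Type*} [Fintype ι] {a b : ℝ} {f : ℝ → ι → ℝ}
    {A : ℝ → Matrix ι ι ℝ} (hA : ∀ i j, ContinuousOn (fun t => A t i j) (Icc a b))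
    (hf : ∀ i, ∀ t ∈ Icc a b, HasDerivWithinAt (fun t => f t i) (∑ j, A t i j * f t j)
      (Icc a b) t)
    (ha : f a = 0) : ∀ t ∈ Icc a b, f t = 0 := by
  refine eq_zero_of_norm_deriv_le_mul_norm (k := fun t => ∑ i, ∑ j, |A t i j|)
    (f' := fun t i => ∑ j, A t i j * f t j)
    (continuousOn_finsetSum _ fun i _ => continuousOn_finsetSum _ fun j _ => (hA i j).abs)
    (fun t ht => hasDerivWithinAt_pi.2 fun i => hf i t ht) (fun t _ => ?_) ha
  refine (pi_norm_le_iff_of_nonneg (by positivity)).2 fun i => ?_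
  calc ‖∑ j, A t i j * f t j‖ ≤ ∑ j, |A t i j| * ‖f t‖ :=
        norm_sum_le_of_le _ fun j _ => by
          rw [norm_mul]
          exact mul_le_mul_of_nonneg_left (norm_le_pi_norm (f t) j) (abs_nonneg _)
    _ = (∑ j, |A t i j|) * ‖f t‖ := (Finset.sum_mul ..).symm
    _ ≤ (∑ i, ∑ j, |A t i j|) * ‖f t‖ := by
        refine mul_le_mul_of_nonneg_right ?_ (norm_nonneg _)
        exact Finset.single_le_sum (f := fun i => ∑ j, |A t i j|)
          (fun i _ => by positivity) (Finset.mem_univ i)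

/-- The coefficients of the linear system satisfied by `(F₁, F₂, F₃)` along solutions in `∂𝓔`. -/
def spinMatrix (p : Fin 6 → ℝ) : Matrix (Fin 3) (Fin 3) ℝ :=
  let x1 := p 3 * (p 4 - p 5) / 2
  let x2 := √2 * p 4 - √2 / 2 * p 5 - p 3 * p 4 / 2
  let x3 := √2 / 2 * p 5 + p 3 * p 5 / 4
  let g := G 1 p - 1
  !![g - x1 - p 3 * (p 4 - p 5) / 2,
      -2 * x1 + p 3 * (p 4 - p 5) / 2 + p 3 * p 4 / 2 + p 3 * p 5 / 2,
      -4 * x1 - p 3 * p 5;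
    -x2 + p 3 * p 4 / 2,
      g - 2 * x2 + √2 * p 4 + √2 / 2 * p 5 - p 3 * p 4,
      -4 * x2 - √2 * p 5;
    -x3 - p 3 * p 5 / 4,
      -2 * x3 - √2 / 2 * p 5,
      g - 4 * x3 + (√2 + p 3 / 2) * p 5]

theorem stmt18 (I : Set ℝ) (hI : I.OrdConnected)
    (c : ℝ → Fin 6 → ℝ) (hc : IsSolution 1 I c)
    (η₀ η₁ : ℝ) (hη₀ : η₀ ∈ I) (hη₁ : η₁ ∈ I) (hle : η₀ ≤ η₁)
    (h0 : c η₀ ∈ bdryE 1 ∩ setP ∩ {p | F1 p = 0 ∧ F2 p = 0 ∧ F3 p = 0}) :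
    c η₁ ∈ bdryE 1 ∩ setP ∩ {p | F1 p = 0 ∧ F2 p = 0 ∧ F3 p = 0} := by
  have hsub : Icc η₀ η₁ ⊆ I := hI.out hη₀ hη₁
  have hV : ∀ i, ∀ t ∈ Icc η₀ η₁,
      HasDerivWithinAt (fun t => c t i) (V 1 (c t) i) (Icc η₀ η₁) t := fun i t ht =>
    hasDerivWithinAt_pi.1 ((hc t (hsub ht)).mono hsub) i
  have hcont : ∀ i, ContinuousOn (fun t => c t i) (Icc η₀ η₁) := fun i t ht =>
    (hV i t ht).continuousWithinAt
  have h0' := hcont 0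
  have h1' := hcont 1
  have h2' := hcont 2
  have h3' := hcont 3
  have h4' := hcont 4
  have h5' := hcont 5
  have hG : ContinuousOn (fun t => G 1 (c t)) (Icc η₀ η₁) := by
    unfold G; fun_prop
  have hL : ContinuousOn (fun t => L 1 (c t)) (Icc η₀ η₁) := by
    unfold L G Rs R1 R2 R3; fun_prop
  obtain ⟨⟨⟨hH, hE⟩, hY1, hY2, hY3⟩, hF1, hF2, hF3⟩ := h0
  have hmem : η₁ ∈ Icc η₀ η₁ := right_mem_Icc.2 hle
  have d0 := fun t ht => hV 0 t ht
  have d1 := fun t ht => hV 1 t ht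
  have d2 := fun t ht => hV 2 t ht
  have d3 := fun t ht => hV 3 t ht
  have d4 := fun t ht => hV 4 t ht
  have d5 := fun t ht => hV 5 t ht
  have hHt : ∀ t ∈ Icc η₀ η₁, c t 0 + 2 * c t 1 + 4 * c t 2 - 1 = 0 := by
    refine eq_zero_of_deriv_eq_mul (g := fun t => G 1 (c t) + L 1 (c t) - 1) (by fun_prop)
      (fun t ht => ?_) (by simpa [sub_eq_zero] using hH)
    refine ((((d0 t ht).add ((d1 t ht).const_mul 2)).add
      ((d2 t ht).const_mul 4)).sub_const 1).congr_deriv ?_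
    simp [V, L, Rs]
    ring
  have hEt : ∀ t ∈ Icc η₀ η₁, G 1 (c t) + Rs 1 (c t) - 1 = 0 := by
    refine eq_zero_of_deriv_eq_mul (g := fun t => 2 * (G 1 (c t) + L 1 (c t))) (by fun_prop)
      (fun t ht => ?_) (by simpa [sub_eq_zero] using hE)
    have e0 := (d0 t ht).pow 2
    have e1 := (d1 t ht).pow 2
    have e2 := (d2 t ht).pow 2
    have e3 := (d3 t ht).pow 2
    have e4 := (d4 t ht).pow 2
    have e5 := (d5 t ht).pow 2
    have r1 := ((e3.mul e4).const_mul (1/2)).add ((e3.mul e5).const_mul (1/4))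
    have r2 := ((e4.const_mul 2).sub ((e3.mul e4).const_mul (1/2))).add (e5.const_mul (1/2))
    have r3 := ((((d4 t ht).mul (d5 t ht)).const_mul 3).sub ((e3.mul e5).const_mul (1/8))).sub
      (e5.const_mul (1/2))
    have key := (((e0.add (e1.const_mul 2)).add (e2.const_mul 4)).add
      ((r1.add (r2.const_mul 2)).add (r3.const_mul 4))).sub_const 1
    refine (key.congr_deriv ?_).congr_of_mem (fun x _ => ?_) ht
    · have hL6 : L 1 (c t) = (G 1 (c t) + Rs 1 (c t) - 1) / 6 := by norm_num [L]
      simp [V, hL6, Rs, G, R1, R2, R3]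
      have hmul : (G 1 (c t) + Rs 1 (c t) - 1) * (c t 0 + 2 * c t 1 + 4 * c t 2 - 1) = 0 := by
        rw [hHt t ht, mul_zero]
      simp only [G, Rs, R1, R2, R3, Nat.cast_one] at hmul
      linear_combination (-1 / 3) * hmul
    · simp [G, Rs, R1, R2, R3]
      ring
  have hFt : ∀ t ∈ Icc η₀ η₁, ![F1 (c t), F2 (c t), F3 (c t)] = 0 := by
    refine eq_zero_of_linear_system (f := fun t => ![F1 (c t), F2 (c t), F3 (c t)])
      (A := fun t => spinMatrix (c t)) (fun i j => ?_) (fun i t ht => ?_) ?_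
    · fin_cases i <;> fin_cases j <;> simp [spinMatrix] <;> fun_prop
    · have hH := hHt t ht
      have hLt : L 1 (c t) = 0 := by simp [L, hEt t ht]
      have hs : √2 ^ 2 = (2 : ℝ) := Real.sq_sqrt (by norm_num)
      fin_cases i
      · refine (((d0 t ht).sub (((d3 t ht).const_mul (1/2)).mul (d4 t ht))).add
          (((d3 t ht).const_mul (1/2)).mul (d5 t ht))).congr_deriv ?_
        simp [V, hLt, Fin.sum_univ_three, spinMatrix, F1, F2, F3, R1]
        linear_combination c t 3 * (c t 4 - c t 5) / 2 * hH
      · refine ((((d1 t ht).sub ((d4 t ht).const_mul √2)).add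
          ((d5 t ht).const_mul (√2/2))).add
            (((d3 t ht).const_mul (1/2)).mul (d4 t ht))).congr_deriv ?_
        simp [V, hLt, Fin.sum_univ_three, spinMatrix, F1, F2, F3, R2]
        linear_combination (-(c t 4)^2 - (c t 5)^2/4) * hs +
          (√2 * c t 4 - √2 / 2 * c t 5 - c t 3 * c t 4 / 2) * hH
      · refine (((d2 t ht).sub ((d5 t ht).const_mul (√2/2))).sub
          (((d3 t ht).const_mul (1/4)).mul (d5 t ht))).congr_deriv ?_
        simp [V, hLt, Fin.sum_univ_three, spinMatrix, F1, F2, F3, R3]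
        linear_combination (-3/2*(c t 4)*(c t 5) + (c t 5)^2/4) * hs +
          (√2 / 2 * c t 5 + c t 3 * c t 5 / 4) * hH
    · ext i
      fin_cases i
      exacts [hF1, hF2, hF3]
  have hF := hFt η₁ hmem
  refine ⟨⟨⟨?_, sub_eq_zero.1 (hEt η₁ hmem)⟩, ?_, ?_, ?_⟩,
    congrFun hF 0, congrFun hF 1, congrFun hF 2⟩
  · simpa [sub_eq_zero] using hHt η₁ hmem
  · refine nonneg_of_deriv_eq_mul (y := fun t => c t 3) (g := fun t => c t 0 - c t 1)
      (by fun_prop) (fun t ht => (d3 t ht).congr_deriv ?_) hY1 η₁ hmem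
    simp [V, mul_comm]
  · refine nonneg_of_deriv_eq_mul (y := fun t => c t 4)
      (g := fun t => G 1 (c t) + L 1 (c t) - c t 1)
      (by fun_prop) (fun t ht => (d4 t ht).congr_deriv ?_) hY2 η₁ hmem
    simp [V, mul_comm]
  · refine nonneg_of_deriv_eq_mul (y := fun t => c t 5)
      (g := fun t => G 1 (c t) + L 1 (c t) + c t 1 - 2 * c t 2)
      (by fun_prop) (fun t ht => (d5 t ht).congr_deriv ?_) hY3 η₁ hmem
    simp [V, mul_comm]


end
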